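/- arXiv:2102.13041 — 2 statements merged into one kernel-verified Lean document; each statement's English description precedes it below -/
import Mathlib

section
/- Let d ≥ 2, s ≥ 1, and let {r_n} ⊂ (0,+∞) with r_n → 0⁺. Let {E_n} be measurable subsets of ℝ^d of finite Lebesgue measure with χ_{E_n} → χ_E strongly in L¹(ℝ^d) for some measurable set E of finite Lebesgue measure. If limsup_{n→∞} J̃_{r_n}^s(E_n)/σ^s(r_n) ≤ M for some finite constant M, then E has finite perimeter. -/
open MeasureTheory Filter Set Metric
open scoped ENNReal NNReal symmDiff

noncomputable section

abbrev Euc (d : ℕ) : Type := EuclideanSpace ℝ (Fin d)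

/-- The kernel `k^s_r`. -/
def ker (d : ℕ) (s r t : ℝ) : ℝ :=
  if t ≤ r then r ^ (-((d : ℝ) + s)) else t ^ (-((d : ℝ) + s))

/-- The regularized `s`-fractional perimeter `J̃_r^s(E) = ∫_E ∫_{Eᶜ} k^s_r(|x-y|) dy dx`. -/
def Jt (d : ℕ) (s r : ℝ) (E : Set (Euc d)) : ℝ≥0∞ :=
  ∫⁻ x in E, ∫⁻ y in Eᶜ, ENNReal.ofReal (ker d s r (dist x y))

/-- The scaling factor `σ^s(r)`. -/
def sgm (d : ℕ) (s r : ℝ) : ℝ :=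
  if s = 1 then |Real.log r| else (((d : ℝ) + s) / ((d : ℝ) + 1)) * r ^ (1 - s) / (s - 1)

/-- The scaling factor `β(r,s)` for the simultaneous limit. -/
def betaScale (d : ℕ) (s r : ℝ) : ℝ :=
  (((d : ℝ) + s) / ((d : ℝ) + 1)) * ((r ^ (1 - s) - 1) / (s - 1)) + 1 / ((d : ℝ) + 1)

/-- `ω_k`: Lebesgue measure of the unit ball in `ℝ^k`. -/
def omegaB (k : ℕ) : ℝ := (volume (ball (0 : Euc k) 1)).toReal

/-- Divergence of a vector field on `ℝ^d`. -/
def diverg {d : ℕ} (Φ : Euc d → Euc d) (x : Euc d) : ℝ :=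
  ∑ i : Fin d, fderiv ℝ Φ x (EuclideanSpace.single i 1) i

/-- De Giorgi perimeter. -/
def Per (d : ℕ) (E : Set (Euc d)) : ℝ≥0∞ :=
  ⨆ (Φ : Euc d → Euc d) (_ : ContDiff ℝ 1 Φ) (_ : HasCompactSupport Φ)
    (_ : ∀ x, ‖Φ x‖ ≤ 1), ENNReal.ofReal (∫ x in E, diverg Φ x)

/-- The cube `lQ + ξ` where `Q = [-1/2, 1/2)^d`. -/
def cube (d : ℕ) (l : ℝ) (ξ : Euc d) : Set (Euc d) :=
  {x | ∀ i, x i ∈ Set.Ico (ξ i - l / 2) (ξ i + l / 2)}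

/-- Half space `H⁻_ν(0)`. -/
def Hminus (d : ℕ) (ν : Euc d) : Set (Euc d) := {y | @inner ℝ _ _ ν y ≤ 0}

/-- Standard (normalized) `k`-dimensional Hausdorff measure on `ℝ^d`:
Mathlib's `μH[k]` uses `diam^k` gauges without the normalizing constant `ω_k/2^k`. -/
def Hstd (d : ℕ) (k : ℕ) : Measure (Euc d) :=
  (ENNReal.ofReal (omegaB k / 2 ^ k)) • (μH[(k : ℝ)] : Measure (Euc d))

/-- The nonlocal `k^s_r`-curvature. -/
def curv (d : ℕ) (s r : ℝ) (E : Set (Euc d)) (x : Euc d) : ℝ :=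
  ∫ y, (Set.indicator Eᶜ (fun _ => (1 : ℝ)) y - Set.indicator E (fun _ => (1 : ℝ)) y)
    * ker d s r (dist x y)

/-- The class `𝔈`: closures of open sets with compact `C²` boundary. -/
def IsC2Domain (d : ℕ) (E : Set (Euc d)) : Prop :=
  ∃ U : Set (Euc d), IsOpen U ∧ E = closure U ∧ IsCompact (frontier U) ∧
    ∃ f : Euc d → ℝ, ContDiff ℝ 2 f ∧ U = {x | f x < 0} ∧ frontier U = {x | f x = 0} ∧
      ∀ x ∈ frontier U, fderiv ℝ f x ≠ 0

def gE {d : ℕ} (E : Set (Euc d)) (h : Euc d) : ℝ≥0∞ := volume {x | x ∈ E ∧ x + h ∉ E}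

lemma gE_meas_set {d : ℕ} {E : Set (Euc d)} (hE : MeasurableSet E) (h : Euc d) :
    MeasurableSet {x | x ∈ E ∧ x + h ∉ E} :=
  hE.inter (hE.compl.preimage (measurable_add_const h))

lemma gE_set2 {d : ℕ} {E : Set (Euc d)} (hE : MeasurableSet E) :
    MeasurableSet {p : Euc d × Euc d | p.2 ∈ E ∧ p.2 + p.1 ∉ E} := by
  have h1 : Measurable (fun p : Euc d × Euc d => p.2 + p.1) := by fun_prop
  exact (hE.preimage measurable_snd).inter (hE.compl.preimage h1)

lemma gE_measurable {d : ℕ} {E : Set (Euc d)} (hE : MeasurableSet E) : Measurable (gE E) :=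
  measurable_measure_prodMk_left (gE_set2 hE)

/-- shift of a set under translation -/
lemma vol_shift {d : ℕ} (S : Set (Euc d)) (h : Euc d) :
    volume {x | x + h ∈ S} = volume S :=
  measure_preimage_add_right volume h S

lemma gE_add {d : ℕ} (E : Set (Euc d)) (a b : Euc d) : gE E (a + b) ≤ gE E a + gE E b := by
  unfold gE
  rw [← vol_shift {x | x ∈ E ∧ x + b ∉ E} a]
  refine (measure_mono ?_).trans (measure_union_le _ _)
  rintro x ⟨h1, h2⟩
  by_cases h : x + a ∈ E
  · right; exact ⟨h, by rwa [add_assoc]⟩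
  · left; exact ⟨h1, h⟩

lemma gE_nsmul {d : ℕ} (E : Set (Euc d)) (a : Euc d) (N : ℕ) : gE E (N • a) ≤ N * gE E a := by
  induction N with
  | zero => simp [gE]
  | succ k ih =>
    rw [succ_nsmul]
    refine (gE_add _ _ _).trans ?_
    push_cast
    rw [add_mul, one_mul]
    gcongr

lemma gE_symmDiff {d : ℕ} (E F : Set (Euc d)) (h : Euc d) :
    gE E h ≤ gE F h + 2 * volume (F ∆ E) := by
  unfold gE
  rw [two_mul]
  nth_rw 2 [← vol_shift (F ∆ E) h]
  refine (measure_mono (t := {x | x ∈ F ∧ x + h ∉ F} ∪ ((F ∆ E) ∪ {x | x + h ∈ F ∆ E})) ?_).trans ?_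
  · rintro x ⟨h1, h2⟩
    simp only [mem_union, Set.mem_ofPred_eq, mem_symmDiff]
    tauto
  · refine (measure_union_le _ _).trans ?_
    gcongr
    exact measure_union_le _ _

lemma Jt_eq {d : ℕ} (s r : ℝ) {E : Set (Euc d)} (hE : MeasurableSet E) :
    Jt d s r E = ∫⁻ h, ENNReal.ofReal (ker d s r ‖h‖) * gE E h := by
  have hk : Measurable (fun h : Euc d => ENNReal.ofReal (ker d s r ‖h‖)) := by
    apply ENNReal.measurable_ofReal.comp
    unfold _root_.ker
    refine Measurable.ite ?_ ?_ ?_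
    · exact measurableSet_le measurable_norm measurable_const
    · fun_prop
    · fun_prop
  have h1 : ∀ x, (∫⁻ y in Eᶜ, ENNReal.ofReal (ker d s r (dist x y))) =
      ∫⁻ h, ENNReal.ofReal (ker d s r ‖h‖) * Eᶜ.indicator 1 (x + h) := by
    intro x
    rw [← lintegral_indicator hE.compl, ← lintegral_add_left_eq_self _ x]
    congr 1; ext h
    by_cases hx : x + h ∈ E <;> simp [hx]
  unfold Jt
  simp_rw [h1]
  rw [← lintegral_indicator hE]
  have h2 : ∀ x, E.indicator (fun x => ∫⁻ h, ENNReal.ofReal (ker d s r ‖h‖) * Eᶜ.indicator 1 (x + h)) x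
     = ∫⁻ h, ENNReal.ofReal (ker d s r ‖h‖) *
        ({p : Euc d × Euc d | p.2 ∈ E ∧ p.2 + p.1 ∉ E}.indicator 1 (h, x)) := by
    intro x
    by_cases hx : x ∈ E
    · simp only [hx, indicator_of_mem]
      congr 1; ext h
      by_cases hh : x + h ∈ E <;> simp [hx, hh]
    · simp [hx]
  simp_rw [h2]
  have hi : Measurable ({p : Euc d × Euc d | p.2 ∈ E ∧ p.2 + p.1 ∉ E}.indicator (1 : Euc d × Euc d → ℝ≥0∞)) :=
    measurable_one.indicator (gE_set2 hE)
  rw [lintegral_lintegral_swap]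
  · congr 1; ext h
    rw [lintegral_const_mul]
    · congr 1
      rw [gE, ← lintegral_indicator_one (gE_meas_set hE h)]
      rfl
    · exact hi.comp (by fun_prop : Measurable fun x : Euc d => (h, x))
  · apply Measurable.aemeasurable
    exact (hk.comp measurable_snd).mul (hi.comp measurable_swap)

def ann (d : ℕ) (ρ : ℝ) : Set (Euc d) := {h | ρ < ‖h‖ ∧ ‖h‖ ≤ 2 * ρ}

lemma ann_meas (d : ℕ) (ρ : ℝ) : MeasurableSet (ann d ρ) :=
  (measurableSet_lt measurable_const measurable_norm).inter
    (measurableSet_le measurable_norm measurable_const)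

lemma gE_ann {d : ℕ} (hd : 2 ≤ d) {E : Set (Euc d)} (hE : MeasurableSet E) {ρ : ℝ} (hρ : 0 < ρ)
    (h : Euc d) (hh : ‖h‖ ≤ ρ / 4) :
    gE E h * volume (ball (0 : Euc d) (ρ / 4)) ≤ 2 * ∫⁻ h in ann d ρ, gE E h := by
  set p : Euc d := EuclideanSpace.single ⟨0, by omega⟩ (3 * ρ / 2) with hp
  have hpn : ‖p‖ = 3 * ρ / 2 := by
    rw [hp, EuclideanSpace.norm_single, Real.norm_of_nonneg (by positivity)]
  have hb : ∀ u : Euc d, ‖u - p‖ < ρ / 2 → u ∈ ann d ρ := by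
    intro u hu
    have h1 := norm_sub_norm_le p u
    have h2 := norm_sub_norm_le u p
    rw [norm_sub_rev] at h1
    constructor <;> linarith
  have hneg : ∀ u : Euc d, u ∈ ann d ρ → -u ∈ ann d ρ := by
    intro u hu
    simpa [ann] using hu
  have hm := gE_measurable hE
  have ha : Measurable ((ann d ρ).indicator (gE E)) := hm.indicator (ann_meas d ρ)
  have e1 : ∫⁻ u, (ann d ρ).indicator (gE E) (-u) = ∫⁻ h in ann d ρ, gE E h := by
    rw [lintegral_neg_eq_self, lintegral_indicator (ann_meas d ρ)]
  have e2 : ∫⁻ u, (ann d ρ).indicator (gE E) (h + u) = ∫⁻ h in ann d ρ, gE E h := by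
    rw [lintegral_add_left_eq_self, lintegral_indicator (ann_meas d ρ)]
  rw [← Measure.addHaar_ball_center volume p, ← setLIntegral_const, two_mul]
  nth_rw 1 [← e1]
  rw [← e2, ← lintegral_add_left (f := fun u => (ann d ρ).indicator (gE E) (-u)) (ha.comp measurable_neg), ← lintegral_indicator measurableSet_ball]
  apply lintegral_mono
  intro u
  by_cases hu : u ∈ ball p (ρ / 4)
  · have hu' : ‖u - p‖ < ρ / 4 := by simpa [dist_eq_norm] using hu
    have m1 : -u ∈ ann d ρ := hneg u (hb u (by linarith))
    have m2 : h + u ∈ ann d ρ := by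
      apply hb
      have := norm_add_le h (u - p)
      rw [show h + u - p = h + (u - p) by abel]
      linarith
    simp only [indicator_of_mem hu, indicator_of_mem m1, indicator_of_mem m2]
    have := gE_add E (-u) (h + u)
    simpa using this
  · simp [hu]
lemma diff_quot {d : ℕ} {E : Set (Euc d)} (hE : MeasurableSet E) (hfin : volume E < ⊤)
    (f : Euc d → ℝ) (hf : Continuous f) (hb : ∀ x, |f x| ≤ 1) (h : Euc d) :
    ENNReal.ofReal (∫ x, (f (x + h) - f x) * E.indicator 1 x) ≤ gE E (-h) + gE E h := by
  have hi : Integrable (E.indicator (1 : Euc d → ℝ)) volume :=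
    (integrable_indicator_iff hE).2 (integrableOn_const hfin.ne)
  have hbd : ∀ u : Euc d, ∀ᵐ x : Euc d, ‖f (x + u)‖ ≤ 1 := fun u => ae_of_all _ fun x => hb _
  have hbd0 : ∀ᵐ x : Euc d, ‖f x‖ ≤ 1 := ae_of_all _ fun x => hb _
  have i1 : Integrable (fun x => f (x + h) * E.indicator 1 x) volume :=
    hi.bdd_mul (hf.comp (continuous_add_const h)).aestronglyMeasurable (hbd h)
  have i2 : Integrable (fun x => f x * E.indicator 1 x) volume :=
    hi.bdd_mul hf.aestronglyMeasurable hbd0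
  have hi' : Integrable (fun x => E.indicator (1 : Euc d → ℝ) (x + -h)) volume :=
    hi.comp_add_right (-h)
  have i3 : Integrable (fun x => f x * E.indicator 1 (x + -h)) volume :=
    hi'.bdd_mul hf.aestronglyMeasurable hbd0
  have e : ∫ x, (f (x + h) - f x) * E.indicator 1 x =
      ∫ x, f x * (E.indicator 1 (x + -h) - E.indicator 1 x) := by
    simp_rw [sub_mul, mul_sub]
    rw [integral_sub i1 i2, integral_sub i3 i2]
    congr 1
    rw [← integral_add_right_eq_self _ (-h)]
    simp
  rw [e]
  refine (ENNReal.ofReal_le_ofReal (le_abs_self _)).trans ?_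
  rw [← Real.norm_eq_abs, ofReal_norm]
  refine (enorm_integral_le_lintegral_enorm _).trans ?_
  have hs : gE E h = volume {x | x + -h ∈ E ∧ x ∉ E} := by
    rw [gE, ← vol_shift {x | x + -h ∈ E ∧ x ∉ E} h]
    simp
  have hms : MeasurableSet {x | x + -h ∈ E ∧ x ∉ E} :=
    (hE.preimage (measurable_add_const (-h))).inter hE.compl
  rw [hs, gE, ← lintegral_indicator_one (gE_meas_set hE (-h)), ← lintegral_indicator_one hms,
    ← lintegral_add_left (measurable_one.indicator (gE_meas_set hE (-h)))]
  apply lintegral_mono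
  intro x
  have hx : ‖f x‖ₑ ≤ 1 := by
    rw [← ofReal_norm]; exact ENNReal.ofReal_le_one.2 (hb x)
  by_cases h1 : x ∈ E <;> by_cases h2 : x + -h ∈ E <;> simp [h1, h2, hx]

lemma Per_lt_top {d : ℕ} {E : Set (Euc d)} (hE : MeasurableSet E) (hfin : volume E < ⊤)
    (C : ℝ) (hC : 0 ≤ C) (hg : ∀ h, gE E h ≤ ENNReal.ofReal (C * ‖h‖)) : Per d E < ⊤ := by
  have hi : Integrable (E.indicator (1 : Euc d → ℝ)) volume :=
    (integrable_indicator_iff hE).2 (integrableOn_const hfin.ne)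
  refine lt_of_le_of_lt ?_ (ENNReal.ofReal_lt_top (r := d * (2 * C)))
  unfold Per
  refine iSup_le fun Φ => iSup_le fun h1 => iSup_le fun h2 => iSup_le fun h3 => ?_
  apply ENNReal.ofReal_le_ofReal
  have hdiff := h1.differentiable one_ne_zero
  have hcomp : ∀ i x, fderiv ℝ (fun y => Φ y i) x = (EuclideanSpace.proj i).comp (fderiv ℝ Φ x) := by
    intro i x
    exact ((EuclideanSpace.proj (𝕜 := ℝ) i).hasFDerivAt.comp x (hdiff x).hasFDerivAt).fderiv
  have hc1 : ∀ i, ContDiff ℝ 1 (fun y => Φ y i) := fun i =>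
    (EuclideanSpace.proj (𝕜 := ℝ) i).contDiff.comp h1
  have hcs : ∀ i, HasCompactSupport (fun y => Φ y i) := fun i =>
    h2.comp_left (g := fun v : Euc d => v i) rfl
  have hint : ∀ i, Integrable (fun x => fderiv ℝ Φ x (EuclideanSpace.single i 1) i) (volume.restrict E) := by
    intro i
    apply Integrable.restrict
    apply Continuous.integrable_of_hasCompactSupport
    · have := h1.continuous_fderiv one_ne_zero
      exact (EuclideanSpace.proj (𝕜 := ℝ) i).continuous.comp (this.clm_apply continuous_const)
    · exact (h2.fderiv (𝕜 := ℝ)).comp_left (g := fun L : Euc d →L[ℝ] Euc d => L (EuclideanSpace.single i 1) i) (by simp)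
  unfold diverg
  rw [integral_finsetSum _ (fun i _ => hint i)]
  have key : ∀ i, ∫ x in E, fderiv ℝ Φ x (EuclideanSpace.single i 1) i ≤ 2 * C := by
    intro i
    obtain ⟨L, hL⟩ := ContDiff.lipschitzWith_of_hasCompactSupport (hcs i) (hc1 i) one_ne_zero
    have ht := hL.integral_inv_smul_sub_mul_tendsto_integral_lineDeriv_mul (μ := volume) hi (EuclideanSpace.single i 1)
    have e : ∫ x in E, fderiv ℝ Φ x (EuclideanSpace.single i 1) i =
        ∫ x, lineDeriv ℝ (fun y => Φ y i) x (EuclideanSpace.single i 1) * E.indicator 1 x := by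
      rw [← integral_indicator hE]
      congr 1; ext x
      rw [(((hc1 i).differentiable one_ne_zero) x).lineDeriv_eq_fderiv, hcomp]
      by_cases hx : x ∈ E <;> simp [hx]
    rw [e]
    refine le_of_tendsto ht ?_
    filter_upwards [self_mem_nhdsWithin] with t (ht : 0 < t)
    have hq := diff_quot hE hfin (fun y => Φ y i) (hc1 i).continuous
      (fun x => (PiLp.norm_apply_le (Φ x) i).trans (h3 x)) (t • EuclideanSpace.single i 1)
    have hn : ‖t • (EuclideanSpace.single i 1 : Euc d)‖ = t := by
      rw [norm_smul, EuclideanSpace.norm_single]; simp [abs_of_pos ht]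
    have g1 := hg (t • EuclideanSpace.single i 1)
    have g2 := hg (-(t • EuclideanSpace.single i 1))
    rw [norm_neg] at g2
    rw [hn] at g1 g2
    have := hq.trans (add_le_add g2 g1)
    rw [← ENNReal.ofReal_add (by positivity) (by positivity),
      ENNReal.ofReal_le_ofReal_iff (by positivity)] at this
    simp_rw [smul_eq_mul, mul_assoc]
    rw [integral_const_mul, inv_mul_le_iff₀ ht]
    linarith
  calc _ ≤ ∑ i : Fin d, 2 * C := Finset.sum_le_sum fun i _ => key i
    _ = _ := by simp

lemma exists_scale (d : ℕ) (s : ℝ) (hs : 1 ≤ s) : ∃ K : ℝ, 0 ≤ K ∧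
    ∀ (E : Set (Euc d)) (_ : MeasurableSet E) (r m : ℝ) (_ : 0 < r) (_ : r < 1 / 4) (_ : 0 ≤ m)
      (_ : Jt d s r E ≤ ENNReal.ofReal m * ENNReal.ofReal (sgm d s r)),
      ∃ ρ, r ≤ ρ ∧ ρ ≤ √r ∧
        ∫⁻ h in ann d ρ, ENNReal.ofReal (ker d s r ‖h‖) * gE E h
          ≤ ENNReal.ofReal (K * m * ρ ^ (1 - s)) := by
  rcases hs.eq_or_lt with rfl | hs1
  · refine ⟨4, by norm_num, ?_⟩
    intro E hE r m hr hr4 hm hJ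
    rw [Jt_eq _ _ hE] at hJ
    simp only [sgm, if_true] at hJ
    have hl2 : 0 < Real.log 2 := Real.log_pos (by norm_num)
    have hl2' : Real.log 2 < 1 := by have := Real.log_two_lt_d9; linarith
    have hlog : Real.log r < - (2 * Real.log 2) := by
      have h4 : Real.log (1 / 4) = -(2 * Real.log 2) := by
        rw [one_div, Real.log_inv, show (4 : ℝ) = 2 ^ 2 by norm_num, Real.log_pow]; norm_num
      rw [← h4]; exact Real.log_lt_log hr hr4
    set L := -Real.log r with hL
    have habs : |Real.log r| = L := abs_of_neg (by linarith)
    rw [habs] at hJ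
    set N := ⌊L / (2 * Real.log 2)⌋₊ with hN
    have hN1 : 1 ≤ N := by
      apply Nat.le_floor
      rw [Nat.cast_one, le_div_iff₀ (by positivity)]; linarith
    have hN1' : (1 : ℝ) ≤ N := by exact_mod_cast hN1
    have hNle : (N : ℝ) * (2 * Real.log 2) ≤ L := by
      rw [← le_div_iff₀ (by positivity)]
      exact Nat.floor_le (div_nonneg (by linarith) (by positivity))
    have hNlt : L < (N + 1) * (2 * Real.log 2) := by
      rw [← div_lt_iff₀ (by positivity)]
      exact Nat.lt_floor_add_one _
    have hL4 : L ≤ 4 * N := by nlinarith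
    have hsq : √r = Real.exp (-(L / 2)) := by
      rw [Real.sqrt_eq_iff_mul_self_eq hr.le (Real.exp_pos _).le, ← Real.exp_add]
      rw [show -(L / 2) + -(L / 2) = Real.log r by rw [hL]; ring, Real.exp_log hr]
    have hpow : ∀ j, j < N → (2 : ℝ) ^ j * r ≤ √r := by
      intro j hj
      have : (2 : ℝ) ^ j = Real.exp (j * Real.log 2) := by
        rw [Real.exp_nat_mul, Real.exp_log (by norm_num)]
      rw [hsq, this]
      nth_rw 1 [← Real.exp_log hr]
      rw [← Real.exp_add, Real.exp_le_exp]
      have : (j : ℝ) ≤ N := by exact_mod_cast hj.le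
      have : (j : ℝ) * Real.log 2 ≤ N * Real.log 2 := by gcongr
      have : Real.log r = -L := by rw [hL]; ring
      linarith
    by_contra! hcon
    have hcon' : ∀ j ∈ Finset.range N, ENNReal.ofReal (4 * m) <
        ∫⁻ h in ann d (2 ^ j * r), ENNReal.ofReal (ker d 1 r ‖h‖) * gE E h := by
      intro j hj
      have := hcon (2 ^ j * r) (le_mul_of_one_le_left hr.le (one_le_pow₀ (by norm_num)))
        (hpow j (Finset.mem_range.1 hj))
      simpa using this
    have hdisj : ((Finset.range N : Finset ℕ) : Set ℕ).PairwiseDisjoint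
        (fun j : ℕ => ann d (2 ^ j * r)) := by
      have aux : ∀ i j : ℕ, i < j → Disjoint (ann d (2 ^ i * r)) (ann d (2 ^ j * r)) := by
        intro i j hij
        rw [Set.disjoint_left]
        rintro x ⟨_, hx⟩ ⟨hx', _⟩
        have : (2 : ℝ) ^ (i + 1) ≤ 2 ^ j := pow_le_pow_right₀ (by norm_num) hij
        have : (2 : ℝ) ^ (i + 1) * r ≤ 2 ^ j * r := by gcongr
        rw [pow_succ] at this
        linarith
      intro i _ j _ hij
      rcases lt_or_gt_of_ne hij with h | h
      · exact aux i j h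
      · exact (aux j i h).symm
    have hsum := lintegral_biUnion_finset (μ := volume) hdisj (fun j _ => ann_meas d _)
      (fun h => ENNReal.ofReal (ker d 1 r ‖h‖) * gE E h)
    have h1 : ∑ j ∈ Finset.range N, ENNReal.ofReal (4 * m) <
        ∑ j ∈ Finset.range N, ∫⁻ h in ann d (2 ^ j * r), ENNReal.ofReal (ker d 1 r ‖h‖) * gE E h :=
      ENNReal.sum_lt_sum_of_nonempty ⟨0, Finset.mem_range.2 hN1⟩ hcon'
    rw [← hsum] at h1
    have h2 := (h1.trans_le (setLIntegral_le_lintegral _ _)).trans_le hJ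
    rw [Finset.sum_const, Finset.card_range, nsmul_eq_mul, ← ENNReal.ofReal_natCast,
      ← ENNReal.ofReal_mul (by positivity), ← ENNReal.ofReal_mul hm] at h2
    refine absurd h2 (not_lt.2 (ENNReal.ofReal_le_ofReal ?_))
    nlinarith
  · have hs1' : 0 < s - 1 := by linarith
    refine ⟨((d : ℝ) + s) / ((d : ℝ) + 1) / (s - 1), by positivity, ?_⟩
    intro E hE r m hr hr4 hm hJ
    rw [Jt_eq _ _ hE] at hJ
    refine ⟨r, le_rfl, ?_, ?_⟩
    · apply Real.le_sqrt_of_sq_le; nlinarith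
    · refine (setLIntegral_le_lintegral _ _).trans (hJ.trans ?_)
      rw [← ENNReal.ofReal_mul hm, sgm, if_neg hs1.ne']
      apply le_of_eq; congr 1; ring

lemma gE_linear_aux {d : ℕ} (hd : 2 ≤ d) {s : ℝ} (hs : 1 ≤ s) {E : Set (Euc d)}
    (hE : MeasurableSet E) {r ρ A : ℝ} (hr : 0 < r) (hρ : r ≤ ρ)
    (hA : ∫⁻ h in ann d ρ, ENNReal.ofReal (ker d s r ‖h‖) * gE E h
          ≤ ENNReal.ofReal (A * ρ ^ (1 - s))) (h : Euc d) (hh : ‖h‖ ≤ ρ / 4) :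
    gE E h ≤ ENNReal.ofReal (2 * 2 ^ ((d : ℝ) + s) * A * 4 ^ d / omegaB d * ρ) := by
  have hρ0 : 0 < ρ := hr.trans_le hρ
  have : Nonempty (Fin d) := ⟨⟨0, by omega⟩⟩
  have hω : 0 < omegaB d :=
    ENNReal.toReal_pos (measure_ball_pos _ _ one_pos).ne' measure_ball_lt_top.ne
  have hω' : volume (ball (0 : Euc d) 1) = ENNReal.ofReal (omegaB d) :=
    (ENNReal.ofReal_toReal measure_ball_lt_top.ne).symm
  have h1 := gE_ann hd hE hρ0 h hh
  have h2 : ∫⁻ h in ann d ρ, gE E h ≤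
      ENNReal.ofReal ((2 * ρ) ^ ((d : ℝ) + s)) * ENNReal.ofReal (A * ρ ^ (1 - s)) := by
    refine le_trans ?_ (mul_le_mul_right hA _)
    rw [← lintegral_const_mul' _ _ ENNReal.ofReal_ne_top]
    apply setLIntegral_mono' (ann_meas d ρ)
    rintro u ⟨hu1, hu2⟩
    rw [← mul_assoc, ← ENNReal.ofReal_mul (by positivity)]
    apply le_mul_of_one_le_left zero_le
    rw [ENNReal.one_le_ofReal, _root_.ker, if_neg (by linarith)]
    have hu0 : 0 < ‖u‖ := by linarith
    rw [Real.rpow_neg hu0.le, ← div_eq_mul_inv, one_le_div (by positivity)]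
    exact Real.rpow_le_rpow hu0.le hu2 (by positivity)
  have h3 := h1.trans (mul_le_mul_right h2 2)
  rw [Measure.addHaar_ball _ _ (by positivity), hω', finrank_euclideanSpace_fin,
    ← ENNReal.ofReal_mul (by positivity), ← ENNReal.ofReal_mul (by positivity),
    show (2 : ℝ≥0∞) = ENNReal.ofReal 2 by simp, ← ENNReal.ofReal_mul (by positivity),
    ← ENNReal.le_div_iff_mul_le (Or.inl (ENNReal.ofReal_pos.2 (by positivity)).ne')
      (Or.inl ENNReal.ofReal_ne_top), ← ENNReal.ofReal_div_of_pos (by positivity)] at h3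
  refine h3.trans (le_of_eq ?_)
  congr 1
  have e : ρ ^ ((d : ℝ) + s) * ρ ^ (1 - s) = ρ ^ d * ρ := by
    rw [← Real.rpow_add hρ0, show (d : ℝ) + s + (1 - s) = ((d + 1 : ℕ) : ℝ) by push_cast; ring,
      Real.rpow_natCast, pow_succ]
  rw [Real.mul_rpow (by norm_num) hρ0.le, div_pow, div_eq_iff (by positivity)]
  have : (2 : ℝ) * (2 ^ ((d : ℝ) + s) * ρ ^ ((d : ℝ) + s) * (A * ρ ^ (1 - s))) =
    2 * 2 ^ ((d : ℝ) + s) * A * (ρ ^ ((d : ℝ) + s) * ρ ^ (1 - s)) := by ring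
  rw [this, e]
  field_simp

lemma gE_linear {d : ℕ} {E : Set (Euc d)} {ρ C : ℝ} (hC : 0 ≤ C) (hρ : 0 < ρ)
    (hg : ∀ h : Euc d, ‖h‖ ≤ ρ / 4 → gE E h ≤ ENNReal.ofReal (C * ρ)) (h : Euc d) :
    gE E h ≤ ENNReal.ofReal (C * (4 * ‖h‖ + ρ)) := by
  set N := ⌊4 * ‖h‖ / ρ⌋₊ + 1 with hN
  have hN0 : (0 : ℝ) < N := by rw [hN]; positivity
  have h1 : 4 * ‖h‖ / ρ < N := by rw [hN]; push_cast; exact Nat.lt_floor_add_one _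
  have h2 : (N : ℝ) ≤ 4 * ‖h‖ / ρ + 1 := by
    rw [hN]; push_cast; gcongr; exact Nat.floor_le (by positivity)
  have e : h = N • ((N : ℝ)⁻¹ • h) := by
    rw [← Nat.cast_smul_eq_nsmul ℝ, smul_smul, mul_inv_cancel₀ hN0.ne', one_smul]
  have hs : ‖(N : ℝ)⁻¹ • h‖ ≤ ρ / 4 := by
    rw [norm_smul, norm_inv, Real.norm_natCast, inv_mul_le_iff₀ hN0]
    rw [div_lt_iff₀ hρ] at h1; linarith
  calc gE E h = gE E (N • ((N : ℝ)⁻¹ • h)) := by rw [← e]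
    _ ≤ N * ENNReal.ofReal (C * ρ) := (gE_nsmul _ _ _).trans (by gcongr; exact hg _ hs)
    _ = ENNReal.ofReal (N * (C * ρ)) := by
      rw [ENNReal.ofReal_mul hN0.le, ENNReal.ofReal_natCast]
    _ ≤ _ := by
      apply ENNReal.ofReal_le_ofReal
      calc (N : ℝ) * (C * ρ) ≤ (4 * ‖h‖ / ρ + 1) * (C * ρ) := by gcongr
        _ = _ := by field_simp

/-- If finite-measure sets `E_n` converge to `E` in `L¹` and the scaled
energies `J̃_{r_n}^s(E_n)/σ^s(r_n)` have limsup at most `M < ∞`, then `E` has finite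
perimeter. -/
theorem stmt8 (d : ℕ) (hd : 2 ≤ d) (s : ℝ) (hs : 1 ≤ s)
    (r : ℕ → ℝ) (hrpos : ∀ n, 0 < r n) (hr0 : Tendsto r atTop (nhds 0))
    (En : ℕ → Set (Euc d)) (hEnmeas : ∀ n, MeasurableSet (En n))
    (hEnfin : ∀ n, volume (En n) < ⊤)
    (E : Set (Euc d)) (hEmeas : MeasurableSet E) (hEfin : volume E < ⊤)
    (hconv : Tendsto (fun n => volume ((En n) ∆ E)) atTop (nhds 0))
    (M : ℝ)
    (hM : Filter.limsup (fun n => Jt d s (r n) (En n) / ENNReal.ofReal (sgm d s (r n))) atTop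
      ≤ ENNReal.ofReal M) :
    Per d E < ⊤ := by
  obtain ⟨K, hK, hscale⟩ := exists_scale d s hs
  set m : ℝ := max M 0 + 1 with hm
  have hm0 : 0 ≤ m := by positivity
  set C : ℝ := 2 * 2 ^ ((d : ℝ) + s) * (K * m) * 4 ^ d / omegaB d with hC
  have hC0 : 0 ≤ C := by
    have : 0 ≤ omegaB d := ENNReal.toReal_nonneg
    positivity
  have hlt : Filter.limsup (fun n => Jt d s (r n) (En n) / ENNReal.ofReal (sgm d s (r n))) atTop
      < ENNReal.ofReal m := by
    refine hM.trans_lt ((ENNReal.ofReal_lt_ofReal_iff (by positivity)).2 ?_)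
    have := le_max_left M 0
    linarith
  have hev := eventually_lt_of_limsup_lt hlt
  have hr4 : ∀ᶠ n in atTop, r n < 1 / 4 := hr0.eventually_lt_const (by norm_num)
  have hbound : ∀ h : Euc d, ∀ᶠ n in atTop,
      gE E h ≤ ENNReal.ofReal (C * (4 * ‖h‖ + √(r n))) + 2 * volume ((En n) ∆ E) := by
    intro h
    filter_upwards [hev, hr4] with n h1 h2
    have hr := hrpos n
    have hsg : 0 < sgm d s (r n) := by
      unfold sgm
      split_ifs with h
      · exact abs_pos.2 (Real.log_neg hr (by linarith)).ne
      · have : 0 < s - 1 := by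
          rcases hs.lt_or_eq with h' | h'
          · linarith
          · exact absurd h'.symm h
        positivity
    have hJ := (ENNReal.div_le_iff (ENNReal.ofReal_pos.2 hsg).ne' ENNReal.ofReal_ne_top).1 h1.le
    obtain ⟨ρ, hρ1, hρ2, hρ3⟩ := hscale (En n) (hEnmeas n) (r n) m hr h2 hm0 hJ
    have hg := gE_linear hC0 (hr.trans_le hρ1)
      (gE_linear_aux hd hs (hEnmeas n) hr hρ1 hρ3) h
    refine (gE_symmDiff E (En n) h).trans ?_
    gcongr
    refine hg.trans (ENNReal.ofReal_le_ofReal ?_)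
    gcongr
  refine Per_lt_top hEmeas hEfin (4 * C) (by positivity) fun h => ?_
  have t1 : Tendsto (fun n => ENNReal.ofReal (C * (4 * ‖h‖ + √(r n))) + 2 * volume ((En n) ∆ E))
      atTop (nhds (ENNReal.ofReal (C * (4 * ‖h‖ + √0)) + 2 * 0)) := by
    refine Tendsto.add ?_ (ENNReal.Tendsto.const_mul hconv (Or.inr (by simp)))
    apply ENNReal.tendsto_ofReal
    exact ((hr0.sqrt).const_add _).const_mul _
  have := ge_of_tendsto t1 (hbound h)
  refine this.trans (le_of_eq ?_)
  simp only [Real.sqrt_zero, mul_zero, add_zero]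
  congr 1; ring

end
end

section
/- Let d ≥ 2 and s ≥ 1. For every ε > 0 there exist r₀ > 0 and δ₀ > 0 such that for every ν ∈ 𝕊^{d−1}, every measurable set E ⊆ ℝ^d of finite Lebesgue measure with |(E △ H⁻_ν(0)) ∩ Q^ν| ≤ δ₀, and every r < r₀, it holds ∫_{Q^ν∩E} ∫_{Q^ν∩E^c} k^s_r(|x−y|) dy dx ≥ ω_{d−1}·(1−ε)·σ^s(r). -/
open MeasureTheory Filter Set Metric
open scoped ENNReal NNReal symmDiff

noncomputable section

lemma polar_hom {d : ℕ} (hd : 2 ≤ d) (f : Euc d → ℝ≥0∞) (hf : Measurable f)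
    (hom : ∀ t : ℝ, 0 < t → ∀ x, f (t • x) = ENNReal.ofReal t * f x)
    (g : ℝ → ℝ≥0∞) (hg : Measurable g) :
    ∫⁻ z, g ‖z‖ * f z = (∫⁻ θ : sphere (0 : Euc d) 1, f θ ∂((volume : Measure (Euc d)).toSphere)) *
      ∫⁻ t in Ioi (0:ℝ), ENNReal.ofReal (t ^ d) * g t := by
  have hdim : Module.finrank ℝ (Euc d) = d := by simp
  have : Nontrivial (Euc d) := Module.nontrivial_of_finrank_pos (R := ℝ) (by omega)
  have h1 : ∫⁻ z, g ‖z‖ * f z = ∫⁻ x : ({(0 : Euc d)}ᶜ : Set (Euc d)), g ‖x.1‖ * f x.1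
      ∂((volume : Measure (Euc d)).comap (↑)) := by
    rw [lintegral_subtype_comap (measurableSet_singleton _).compl fun x ↦ g ‖x‖ * f x,
        restrict_compl_singleton]
  rw [h1]
  have h2 := (volume : Measure (Euc d)).measurePreserving_homeomorphUnitSphereProd.lintegral_comp_emb
    (Homeomorph.measurableEmbedding _) (fun p => g p.2.1 * (ENNReal.ofReal p.2.1 * f p.1.1))
  have h3 : ∀ x : ({(0 : Euc d)}ᶜ : Set (Euc d)), g ‖x.1‖ * f x.1 =
     (fun p : sphere (0 : Euc d) 1 × Ioi (0 : ℝ) => g p.2.1 * (ENNReal.ofReal p.2.1 * f p.1.1)) (homeomorphUnitSphereProd _ x) := by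
    intro x
    have hx : 0 < ‖x.1‖ := norm_pos_iff.2 x.2
    simp only [homeomorphUnitSphereProd_apply_snd_coe, homeomorphUnitSphereProd_apply_fst_coe]
    rw [← hom _ hx, smul_smul, mul_inv_cancel₀ hx.ne', one_smul]
  rw [lintegral_congr h3, h2, hdim]
  have h4 : ∀ p : sphere (0 : Euc d) 1 × Ioi (0 : ℝ), g p.2.1 * (ENNReal.ofReal p.2.1 * f p.1.1)
      = f p.1.1 * (ENNReal.ofReal p.2.1 * g p.2.1) := by intro p; ring
  rw [lintegral_congr h4, lintegral_prod_mul (f := fun a : sphere (0 : Euc d) 1 => f a.1)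
    (g := fun t : Ioi (0:ℝ) => ENNReal.ofReal t.1 * g t.1) (by fun_prop) (by fun_prop)]
  congr 1
  rw [Measure.volumeIoiPow, lintegral_withDensity_eq_lintegral_mul _ (by fun_prop) (by fun_prop)]
  rw [← lintegral_subtype_comap measurableSet_Ioi]
  refine lintegral_congr fun t => ?_
  have ht : (0:ℝ) < t.1 := t.2
  simp only [Pi.mul_apply]
  rw [← mul_assoc, ← ENNReal.ofReal_mul (by positivity), ← pow_succ, Nat.sub_add_cancel (by omega)]

lemma energy_eq {d : ℕ} (P M : Set (Euc d)) (hM : MeasurableSet M)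
    (g : ℝ → ℝ≥0∞) (hg : Measurable g) :
    ∫⁻ x in P, ∫⁻ y in M, g (dist x y) = ∫⁻ z, g ‖z‖ * volume (P ∩ (fun x => x + z) ⁻¹' M) := by
  have h1 : ∀ x : Euc d, ∫⁻ y in M, g (dist x y) = ∫⁻ z, M.indicator 1 (x + z) * g ‖z‖ := by
    intro x
    rw [← lintegral_indicator hM, ← lintegral_add_left_eq_self _ x]
    refine lintegral_congr fun z => ?_
    by_cases h : x + z ∈ M <;> simp [h]
  have hm : MeasurableSet {p : Euc d × Euc d | p.1 + p.2 ∈ M} := (by fun_prop : Measurable (fun p : Euc d × Euc d => p.1 + p.2)) hM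
  have hm2 : Measurable (fun p : Euc d × Euc d => M.indicator (1 : Euc d → ℝ≥0∞) (p.1 + p.2)) :=
    (measurable_one.indicator hM).comp (by fun_prop)
  simp_rw [h1]
  rw [lintegral_lintegral_swap (by
    apply Measurable.aemeasurable
    exact hm2.mul (by fun_prop))]
  refine lintegral_congr fun z => ?_
  have hz : MeasurableSet ((fun x : Euc d => x + z) ⁻¹' M) := (measurable_add_const z) hM
  rw [lintegral_mul_const _ (by exact (measurable_one.indicator hM).comp (by fun_prop)), mul_comm]
  congr 1
  have : ∀ x, M.indicator (1 : Euc d → ℝ≥0∞) (x + z) = ((fun x : Euc d => x + z) ⁻¹' M).indicator 1 x := by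
    intro x; rfl
  simp_rw [this]
  rw [lintegral_indicator_one hz, Measure.restrict_apply hz, inter_comm]

lemma path_bound {d : ℕ} (Q E : Set (Euc d)) (hQ : Convex ℝ Q) (z : Euc d) (N : ℕ) :
    volume ((Q ∩ E) ∩ (fun x => x + (N : ℝ) • z) ⁻¹' (Q ∩ Eᶜ)) ≤
      N * volume ((Q ∩ E) ∩ (fun x => x + z) ⁻¹' (Q ∩ Eᶜ)) := by
  set A := (Q ∩ E) ∩ (fun x => x + z) ⁻¹' (Q ∩ Eᶜ) with hA
  have hsub : (Q ∩ E) ∩ (fun x => x + (N : ℝ) • z) ⁻¹' (Q ∩ Eᶜ) ⊆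
      ⋃ j ∈ Finset.range N, (fun x => x + (j : ℝ) • z) ⁻¹' A := by
    rintro x ⟨⟨hxQ, hxE⟩, hyQ, hyE⟩
    have hN : 0 < N := by
      rcases Nat.eq_zero_or_pos N with h | h
      · subst h; simp at hyE; exact absurd hxE hyE
      · exact h
    have hq : ∀ j : ℕ, j ≤ N → x + (j : ℝ) • z ∈ Q := by
      intro j hj
      have := hQ.add_smul_mem hxQ hyQ (t := (j : ℝ) / N)
        ⟨by positivity, by rw [div_le_one (by positivity)]; exact_mod_cast hj⟩
      rwa [smul_smul, div_mul_cancel₀ _ (by positivity)] at this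
    have hex : ∃ j : ℕ, x + (j : ℝ) • z ∉ E := ⟨N, hyE⟩
    classical
    set m := Nat.find hex with hm
    have hm1 := Nat.find_spec hex
    have hmN : m ≤ N := Nat.find_min' hex hyE
    have hm0 : m ≠ 0 := by
      intro h; rw [← hm, h] at hm1; simp at hm1; exact hm1 hxE
    obtain ⟨k, hk⟩ := Nat.exists_eq_succ_of_ne_zero hm0
    have hkE : x + (k : ℝ) • z ∈ E := by
      by_contra h
      have := Nat.find_min' hex h
      omega
    have heq : x + (k : ℝ) • z + z = x + (m : ℝ) • z := by
      rw [hk]; push_cast; rw [add_smul, one_smul, add_assoc]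
    simp only [mem_iUnion, Finset.mem_range]
    refine ⟨k, by omega, ⟨hq k (by omega), hkE⟩, ?_, ?_⟩
    · simp only [heq]; exact hq m hmN
    · simp only [heq]; exact hm1
  calc _ ≤ _ := measure_mono hsub
    _ ≤ ∑ j ∈ Finset.range N, volume ((fun x => x + (j : ℝ) • z) ⁻¹' A) := measure_biUnion_finset_le _ _
    _ = _ := by simp [measure_preimage_add_right]

lemma box_vol {d : ℕ} (i0 : Fin d) (a b : ℝ) (ha : 0 ≤ a) (hb : 0 ≤ b) :
    volume {x : Euc d | ∀ i, x i ∈ if i = i0 then Ioc (-a) 0 else Ico (-b) b} =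
      ENNReal.ofReal (a * (2 * b) ^ (d - 1)) := by
  have h := (PiLp.volume_preserving_ofLp (Fin d)).measure_preimage
    (s := Set.pi univ fun i => if i = i0 then Ioc (-a) 0 else Ico (-b) b)
    (MeasurableSet.univ_pi (fun i => by split_ifs <;> measurability)).nullMeasurableSet
  have h2 : {x : Euc d | ∀ i, x i ∈ if i = i0 then Ioc (-a) 0 else Ico (-b) b} =
      (@WithLp.ofLp 2 (Fin d → ℝ)) ⁻¹' (Set.pi univ fun i => if i = i0 then Ioc (-a) 0 else Ico (-b) b) := by
    ext x; simp
  rw [h2, h, volume_pi_pi, ← Finset.mul_prod_erase _ _ (Finset.mem_univ i0)]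
  rw [Finset.prod_congr rfl (g := fun _ => ENNReal.ofReal (2 * b))]
  · simp [Finset.card_erase_of_mem, ENNReal.ofReal_mul ha]
    rw [ENNReal.ofReal_pow (by positivity), ENNReal.ofReal_mul (by norm_num)]
    simp
  · intro i hi
    rw [Finset.mem_erase] at hi
    simp [hi.1, two_mul]

lemma convex_cube (d : ℕ) : Convex ℝ (cube d 1 0) := by
  have : cube d 1 0 = ⋂ i : Fin d, (EuclideanSpace.proj (𝕜 := ℝ) i : Euc d →L[ℝ] ℝ) ⁻¹' (Ico (-(1/2)) (1/2)) := by
    ext x; simp [cube]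
  rw [this]
  exact convex_iInter fun i => (convex_Ico _ _).is_linear_preimage
    (ContinuousLinearMap.toLinearMap (EuclideanSpace.proj (𝕜 := ℝ) i : Euc d →L[ℝ] ℝ)).isLinear

lemma meas_cube (d : ℕ) : MeasurableSet (cube d 1 0) := by
  have : cube d 1 0 = ⋂ i : Fin d, (EuclideanSpace.proj (𝕜 := ℝ) i : Euc d →L[ℝ] ℝ) ⁻¹' (Ico (-(1/2)) (1/2)) := by
    ext x; simp [cube]
  rw [this]
  exact MeasurableSet.iInter fun i => (EuclideanSpace.proj (𝕜 := ℝ) i : Euc d →L[ℝ] ℝ).continuous.measurable measurableSet_Ico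

lemma half_bound {d : ℕ} (i0 : Fin d) (R : Euc d ≃ₗᵢ[ℝ] Euc d) (u : Euc d) (T : ℝ) (hT : T ≤ 1/4)
    (hu : ‖u‖ ≤ T) (hu0 : 0 ≤ u i0) :
    ENNReal.ofReal (u i0 * (1 - 2 * T) ^ (d - 1)) ≤
      volume ((R '' cube d 1 0 ∩ Hminus d (R (EuclideanSpace.single i0 1))) ∩
        (fun x => x + R u) ⁻¹' (R '' cube d 1 0 ∩ (Hminus d (R (EuclideanSpace.single i0 1)))ᶜ)) := by
  have hi : ∀ i, |u i| ≤ T := fun i => le_trans (by simpa using PiLp.norm_apply_le u i) hu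
  have hb := box_vol i0 (u i0) (1/2 - T) hu0 (by linarith)
  rw [show 2 * (1/2 - T) = 1 - 2 * T by ring] at hb
  rw [← hb]
  refine le_trans ?_ (R.measurePreserving.measure_preimage_emb R.toHomeomorph.measurableEmbedding _).le
  apply measure_mono
  intro x hx
  have hx0 := hx i0
  simp only [if_true] at hx0
  have hT0 : 0 ≤ T := (norm_nonneg u).trans hu
  have hin : ∀ y : Euc d, (R y ∈ Hminus d (R (EuclideanSpace.single i0 1))) ↔ y i0 ≤ 0 := by
    intro y
    simp [Hminus, EuclideanSpace.inner_single_left]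
  have hadd : R x + R u = R (x + u) := (map_add R x u).symm
  have hmem : ∀ y : Euc d, (R y ∈ R '' cube d 1 0) ↔ ∀ i, -(1/2) ≤ y i ∧ y i < 1/2 := by
    intro y
    rw [R.injective.mem_set_image]
    simp [cube]
  simp only [mem_preimage, mem_inter_iff, mem_compl_iff, hadd, hin, hmem]
  have hi0 := abs_le.1 (hi i0)
  refine ⟨⟨fun i => ?_, hx0.2⟩, fun i => ?_, ?_⟩
  · by_cases h : i = i0
    · subst h
      constructor <;> linarith [hx0.1, hx0.2]
    · have := hx i
      simp only [h, if_false, mem_Ico] at this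
      constructor <;> linarith [this.1, this.2]
  · simp only [PiLp.add_apply]
    by_cases h : i = i0
    · subst h
      constructor <;> linarith [hx0.1, hx0.2]
    · have := hx i
      simp only [h, if_false, mem_Ico] at this
      have h3 := abs_le.1 (hi i)
      constructor <;> linarith [this.1, this.2]
  · simp only [PiLp.add_apply]
    linarith [hx0.1]

lemma A_bound {d : ℕ} (i0 : Fin d) (R : Euc d ≃ₗᵢ[ℝ] Euc d) (E : Set (Euc d)) (u : Euc d) (T δ : ℝ)
    (hT0 : 0 < T) (hT : T ≤ 1/4) (hδ : 0 ≤ δ) (hu : ‖u‖ ≤ T / 2)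
    (hE : volume ((E ∆ Hminus d (R (EuclideanSpace.single i0 1))) ∩ (R '' cube d 1 0)) ≤ ENNReal.ofReal δ) :
    ENNReal.ofReal ((1 - 2 * T) ^ (d - 1) * u i0 - 4 * δ / T * ‖u‖) ≤
      volume ((R '' cube d 1 0 ∩ E) ∩ (fun x => x + R u) ⁻¹' (R '' cube d 1 0 ∩ Eᶜ)) := by
  set c := (1 - 2 * T) ^ (d - 1) with hc
  have hc0 : 0 ≤ c := by rw [hc]; apply pow_nonneg; linarith
  rcases le_or_gt (u i0) 0 with h0 | h0
  · rw [ENNReal.ofReal_of_nonpos]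
    · exact zero_le
    · have : 0 ≤ 4 * δ / T * ‖u‖ := by positivity
      nlinarith
  have hun : 0 < ‖u‖ := by
    rw [norm_pos_iff]; rintro rfl; simp at h0
  set N := ⌊T / ‖u‖⌋₊ with hN
  have hN1 : (N : ℝ) ≤ T / ‖u‖ := Nat.floor_le (by positivity)
  have hN2 : T / ‖u‖ < N + 1 := Nat.lt_floor_add_one _
  have hN3 : 2 ≤ T / ‖u‖ := by rw [le_div_iff₀ hun]; linarith
  have hN4 : T / ‖u‖ ≤ 2 * N := by linarith
  have hN5 : (0:ℝ) < N := by linarith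
  have hNT : N * ‖u‖ ≤ T := by rwa [le_div_iff₀ hun] at hN1
  have hNT2 : T ≤ 2 * N * ‖u‖ := by rwa [div_le_iff₀ hun] at hN4
  set H := Hminus d (R (EuclideanSpace.single i0 1)) with hH
  set Q := R '' cube d 1 0 with hQ
  have hconv : Convex ℝ Q := (convex_cube d).is_linear_image R.toLinearEquiv.toLinearMap.isLinear
  have h1 := half_bound i0 R ((N : ℝ) • u) T hT (by simpa [norm_smul] using hNT)
    (by simp; positivity)
  rw [← hH, ← hQ, ← hc] at h1
  have h2 := path_bound Q E hconv (R u) N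
  rw [map_smul] at h1
  set w := (N : ℝ) • R u with hw
  have h3 : volume ((Q ∩ H) ∩ (fun x => x + w) ⁻¹' (Q ∩ Hᶜ)) ≤
      volume ((Q ∩ E) ∩ (fun x => x + w) ⁻¹' (Q ∩ Eᶜ)) + ENNReal.ofReal δ + ENNReal.ofReal δ := by
    have hs : (Q ∩ H) ∩ (fun x => x + w) ⁻¹' (Q ∩ Hᶜ) ⊆
        ((Q ∩ E) ∩ (fun x => x + w) ⁻¹' (Q ∩ Eᶜ) ∪ ((E ∆ H) ∩ Q)) ∪ (fun x => x + w) ⁻¹' ((E ∆ H) ∩ Q) := by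
      rintro x ⟨⟨h1, h2⟩, h3, h4⟩
      simp only [mem_union, mem_inter_iff, mem_preimage, mem_symmDiff, mem_compl_iff] at *
      tauto
    refine (measure_mono hs).trans ((measure_union_le _ _).trans ?_)
    refine add_le_add ((measure_union_le _ _).trans (add_le_add le_rfl hE)) ?_
    rwa [measure_preimage_add_right]
  set A := volume ((Q ∩ E) ∩ (fun x => x + R u) ⁻¹' (Q ∩ Eᶜ)) with hA
  have h4 : ENNReal.ofReal (N * u i0 * c) ≤ N * A + ENNReal.ofReal (2 * δ) := by
    have : ((N : ℝ) • u) i0 = N * u i0 := by simp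
    rw [this] at h1
    refine h1.trans (h3.trans ?_)
    rw [two_mul, ENNReal.ofReal_add hδ hδ, ← add_assoc]
    gcongr
  have h5 : (N : ℝ≥0∞) * ENNReal.ofReal (c * u i0 - 4 * δ / T * ‖u‖) ≤ N * A := by
    rw [← ENNReal.ofReal_natCast, ← ENNReal.ofReal_mul hN5.le, ENNReal.ofReal_natCast]
    have h6 : N * (c * u i0 - 4 * δ / T * ‖u‖) ≤ N * u i0 * c - 2 * δ := by
      have : 2 * δ ≤ N * (4 * δ / T * ‖u‖) := by
        rw [show N * (4 * δ / T * ‖u‖) = (2 * δ) * (2 * N * ‖u‖) / T by ring, le_div_iff₀ hT0]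
        gcongr
      linarith
    refine (ENNReal.ofReal_le_ofReal h6).trans ?_
    rw [ENNReal.ofReal_sub _ (by positivity)]
    exact tsub_le_iff_right.2 h4
  exact (ENNReal.mul_le_mul_iff_right (by exact_mod_cast hN5.ne') (ENNReal.natCast_ne_top N)).1 h5

lemma sphere_const {d : ℕ} (hd : 2 ≤ d) (i0 : Fin d) :
    ∫⁻ θ : sphere (0 : Euc d) 1, ENNReal.ofReal (θ.1 i0) ∂((volume : Measure (Euc d)).toSphere)
      = ENNReal.ofReal (omegaB (d - 1)) := by
  have hpol := polar_hom hd (fun z => ENNReal.ofReal (z i0)) (by fun_prop)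
    (by intro t ht x; simp [ENNReal.ofReal_mul ht.le])
    (fun t => ENNReal.ofReal (Real.exp (-t ^ 2))) (by fun_prop)
  have hdpos : (0:ℝ) < d := by exact_mod_cast (by omega : 0 < d)
  have hG : 0 < Real.Gamma (((d:ℝ) + 1) / 2) := Real.Gamma_pos_of_pos (by positivity)
  -- radial part
  have hrad : ∫⁻ t in Ioi (0:ℝ), ENNReal.ofReal (t ^ d) * ENNReal.ofReal (Real.exp (-t ^ 2)) =
      ENNReal.ofReal (1 / 2 * Real.Gamma (((d:ℝ) + 1) / 2)) := by
    rw [← integral_rpow_mul_exp_neg_rpow (by norm_num : (0:ℝ) < 2) (by linarith : (-1:ℝ) < d)]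
    rw [ofReal_integral_eq_lintegral_ofReal]
    · refine setLIntegral_congr_fun measurableSet_Ioi fun t ht => ?_
      have ht' : (0:ℝ) < t := ht
      simp only [Real.rpow_natCast, Real.rpow_two]
      rw [ENNReal.ofReal_mul (by positivity)]
    · exact integrableOn_rpow_mul_exp_neg_rpow (by linarith) (by norm_num)
    · filter_upwards [ae_restrict_mem measurableSet_Ioi] with t ht
      have ht' : (0:ℝ) < t := ht
      simp only [Pi.zero_apply]
      positivity
  -- product part
  set φ : Fin d → ℝ → ℝ := fun i => if i = i0 then
    (Ioi (0:ℝ)).indicator (fun x => x ^ (1:ℝ) * Real.exp (-x ^ (2:ℝ))) else fun x => Real.exp (-1 * x ^ 2) with hφ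
  have hφint : ∀ i, Integrable (φ i) := by
    intro i
    by_cases h : i = i0
    · simp only [hφ, h, if_true]
      rw [integrable_indicator_iff measurableSet_Ioi]
      exact integrableOn_rpow_mul_exp_neg_rpow (by norm_num) (by norm_num)
    · simp only [hφ, h, if_false]
      exact integrable_exp_neg_mul_sq (by norm_num)
  have hφ0 : ∀ i x, 0 ≤ φ i x := by
    intro i x
    by_cases h : i = i0
    · simp only [hφ, h, if_true]
      apply indicator_nonneg
      intro y hy
      have : (0:ℝ) < y := hy
      positivity
    · simp only [hφ, h, if_false]; positivity
  have hφI : ∏ i, ∫ x, φ i x = 1 / 2 * √Real.pi ^ (d - 1) := by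
    rw [← Finset.mul_prod_erase _ _ (Finset.mem_univ i0)]
    rw [Finset.prod_congr rfl (g := fun _ => √Real.pi)]
    · simp only [hφ, if_true]
      rw [integral_indicator measurableSet_Ioi, integral_rpow_mul_exp_neg_rpow (by norm_num) (by norm_num)]
      norm_num [Finset.card_erase_of_mem]
    · intro i hi
      rw [Finset.mem_erase] at hi
      simp only [hφ, hi.1, if_false]
      rw [integral_gaussian]; simp
  have hprod : ∫⁻ z : Euc d, ENNReal.ofReal (Real.exp (-‖z‖ ^ 2)) * ENNReal.ofReal (z i0) =
      ENNReal.ofReal (1 / 2 * √Real.pi ^ (d - 1)) := by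
    rw [← hφI, ← integral_fintype_prod_volume_eq_prod, ofReal_integral_eq_lintegral_ofReal
      (μ := (volume : Measure (Fin d → ℝ))) (f := fun x => ∏ i, φ i (x i)) (Integrable.fintype_prod hφint) (.of_forall fun x => Finset.prod_nonneg fun i _ => hφ0 i _)]
    rw [← (PiLp.volume_preserving_ofLp (Fin d)).lintegral_comp_emb
      (MeasurableEquiv.toLp 2 (Fin d → ℝ)).symm.measurableEmbedding]
    refine lintegral_congr fun z => ?_
    rw [← ENNReal.ofReal_mul (Real.exp_pos _).le]
    rw [EuclideanSpace.norm_sq_eq, ← Finset.sum_neg_distrib, Real.exp_sum,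
      ← Finset.mul_prod_erase _ _ (Finset.mem_univ i0), ← Finset.mul_prod_erase _ (fun i => φ i _) (Finset.mem_univ i0)]
    have he : ∏ i ∈ Finset.univ.erase i0, φ i (z i) = ∏ i ∈ Finset.univ.erase i0, Real.exp (-‖z i‖ ^ 2) := by
      refine Finset.prod_congr rfl fun i hi => ?_
      rw [Finset.mem_erase] at hi
      simp [hφ, hi.1]
    rw [he]
    simp only [hφ, if_true]
    by_cases h : 0 < z i0
    · rw [indicator_of_mem (by exact h)]
      congr 1
      simp
      ring
    · rw [indicator_of_notMem (by exact h)]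
      rw [zero_mul, ENNReal.ofReal_zero, ENNReal.ofReal_of_nonpos]
      apply mul_nonpos_of_nonneg_of_nonpos
      · positivity
      · linarith
  rw [hprod, hrad] at hpol
  have hω : omegaB (d - 1) = √Real.pi ^ (d - 1) / Real.Gamma (((d:ℝ) + 1) / 2) := by
    have : Nonempty (Fin (d - 1)) := ⟨⟨0, by omega⟩⟩
    rw [omegaB, EuclideanSpace.volume_ball]
    have h1 : ((d - 1 : ℕ) : ℝ) / 2 + 1 = ((d:ℝ) + 1) / 2 := by
      rw [Nat.cast_sub (by omega)]; push_cast; ring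
    simp only [Fintype.card_fin, h1]
    simp
    positivity
  have hne : ENNReal.ofReal (1 / 2 * Real.Gamma (((d:ℝ) + 1) / 2)) ≠ 0 := by
    simp; positivity
  have h3 : ENNReal.ofReal (omegaB (d - 1)) * ENNReal.ofReal (1 / 2 * Real.Gamma (((d:ℝ) + 1) / 2)) =
      ENNReal.ofReal (1 / 2 * √Real.pi ^ (d - 1)) := by
    rw [← ENNReal.ofReal_mul (by rw [hω]; positivity), hω]
    congr 1
    field_simp
  rw [← h3] at hpol
  exact ((ENNReal.mul_left_inj hne ENNReal.ofReal_ne_top).1 hpol).symm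

/-- truncated kernel integral -/
lemma ker_int (d : ℕ) (s r ρ : ℝ) (hr : 0 < r) (hrρ : r < ρ) :
    ENNReal.ofReal (r ^ (1 - s) / (d + 1) + ∫ t in r..ρ, t ^ (-s)) ≤
      ∫⁻ t in Ioi (0:ℝ), ENNReal.ofReal (t ^ d) * (Iic ρ).indicator (fun t => ENNReal.ofReal (_root_.ker d s r t)) t := by
  have h0 : (∫ t in (0:ℝ)..r, t ^ d * r ^ (-((d : ℝ) + s))) = r ^ (1 - s) / (d + 1) := by
    rw [intervalIntegral.integral_mul_const, integral_pow]
    rw [zero_pow (by omega), sub_zero, div_mul_eq_mul_div, ← Real.rpow_natCast, ← Real.rpow_add hr]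
    congr 2; push_cast; ring
  have hi1 : IntervalIntegrable (fun t : ℝ => t ^ d * r ^ (-((d : ℝ) + s))) volume 0 r := by
    apply Continuous.intervalIntegrable; fun_prop
  have hi2 : IntervalIntegrable (fun t : ℝ => t ^ (-s)) volume r ρ := by
    apply intervalIntegral.intervalIntegrable_rpow
    right
    rw [uIcc_of_le hrρ.le]
    simp [hr]
  have p1 : 0 ≤ ∫ t in (0:ℝ)..r, t ^ d * r ^ (-((d : ℝ) + s)) := by rw [h0]; positivity
  have p2 : 0 ≤ ∫ t in r..ρ, t ^ (-s) := by
    apply intervalIntegral.integral_nonneg hrρ.le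
    intro t ht
    have : 0 < t := hr.trans_le ht.1
    positivity
  rw [← h0, ENNReal.ofReal_add p1 p2]
  have hsub : Ioc 0 r ∪ Ioc r ρ ⊆ Ioi (0:ℝ) := by
    rintro t (h | h)
    · exact h.1
    · exact hr.trans h.1
  refine le_trans ?_ (lintegral_mono_set hsub)
  rw [lintegral_union measurableSet_Ioc (by
    rw [Set.disjoint_left]; intro t h1 h2; exact absurd h2.1 (not_lt.2 h1.2))]
  apply add_le_add
  · rw [intervalIntegral.integral_of_le hr.le, ofReal_integral_eq_lintegral_ofReal hi1.1]
    · apply le_of_eq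
      refine setLIntegral_congr_fun measurableSet_Ioc fun t ht => ?_
      have h1 : t ∈ Iic ρ := ht.2.trans hrρ.le
      have := ht.1
      simp only [indicator_of_mem h1, _root_.ker, ht.2, if_true]
      rw [ENNReal.ofReal_mul (by positivity)]
    · filter_upwards [ae_restrict_mem measurableSet_Ioc] with t ht
      have := ht.1
      simp only [Pi.zero_apply]
      positivity
  · rw [intervalIntegral.integral_of_le hrρ.le, ofReal_integral_eq_lintegral_ofReal hi2.1]
    · apply le_of_eq
      refine setLIntegral_congr_fun measurableSet_Ioc fun t ht => ?_
      have h1 : t ∈ Iic ρ := ht.2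
      have h3 := ht.1
      have h2 : 0 < t := hr.trans h3
      simp only [indicator_of_mem h1, _root_.ker, not_le.2 h3, if_false]
      rw [← ENNReal.ofReal_mul (by positivity), ← Real.rpow_natCast, ← Real.rpow_add h2]
      congr 2; ring
    · filter_upwards [ae_restrict_mem measurableSet_Ioc] with t ht
      have := hr.trans ht.1
      simp only [Pi.zero_apply]
      positivity

lemma sgm_asymp (d : ℕ) (s ρ : ℝ) (hs : 1 ≤ s) (hρ : 0 < ρ) (η : ℝ) (hη : 0 < η) :
    ∃ r₀ : ℝ, 0 < r₀ ∧ r₀ ≤ ρ ∧ r₀ ≤ 1 ∧ ∀ r : ℝ, 0 < r → r < r₀ →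
      (1 - η) * sgm d s r ≤ r ^ (1 - s) / (d + 1) + ∫ t in r..ρ, t ^ (-s) := by
  rcases hs.eq_or_lt with h1 | h1
  · subst h1
    refine ⟨min (min ρ 1) (ρ ^ (1/η)), by positivity, (min_le_left _ _).trans (min_le_left _ _),
      (min_le_left _ _).trans (min_le_right _ _), fun r hr hlt => ?_⟩
    rw [lt_min_iff, lt_min_iff] at hlt
    obtain ⟨⟨h1, h2⟩, h3⟩ := hlt
    have hl := Real.log_lt_log hr h3
    rw [Real.log_rpow hρ] at hl
    have hl0 : Real.log r < 0 := Real.log_neg hr h2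
    have hint : ∫ t in r..ρ, t ^ (-(1:ℝ)) = Real.log ρ - Real.log r := by
      simp_rw [Real.rpow_neg_one]
      rw [integral_inv_of_pos hr hρ, Real.log_div hρ.ne' hr.ne']
    rw [hint]
    simp only [sgm, if_true, abs_of_neg hl0, sub_self, Real.rpow_zero]
    have h4 : η * Real.log r ≤ Real.log ρ := by
      have := mul_le_mul_of_nonneg_left hl.le hη.le
      rwa [← mul_assoc, mul_one_div_cancel hη.ne', one_mul] at this
    have : (0:ℝ) ≤ 1 / (d + 1) := by positivity
    linarith
  · -- r ^ (1-s) → ∞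
    have ht : Tendsto (fun r : ℝ => r ^ (1 - s)) (nhdsWithin 0 (Ioi 0)) atTop :=
      tendsto_rpow_neg_nhdsGT_zero (by linarith)
    obtain ⟨a, ha, ha'⟩ := mem_nhdsGT_iff_exists_Ioo_subset.1 (ht.eventually_ge_atTop (ρ ^ (1 - s) / η))
    have ha0 : (0:ℝ) < a := ha
    refine ⟨min (min ρ 1) a, by positivity, (min_le_left _ _).trans (min_le_left _ _),
      (min_le_left _ _).trans (min_le_right _ _), fun r hr hlt => ?_⟩
    rw [lt_min_iff, lt_min_iff] at hlt
    obtain ⟨⟨h2, h3⟩, h4⟩ := hlt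
    have h5 : ρ ^ (1 - s) / η ≤ r ^ (1 - s) := ha' ⟨hr, h4⟩
    have hs1 : 0 < s - 1 := by linarith
    have hint : ∫ t in r..ρ, t ^ (-s) = (r ^ (1 - s) - ρ ^ (1 - s)) / (s - 1) := by
      rw [integral_rpow]
      · rw [show -s + 1 = 1 - s by ring, ← neg_div_neg_eq]; congr 1 <;> ring
      · right
        refine ⟨by linarith, ?_⟩
        rw [uIcc_of_le h2.le]
        simp [hr]
    rw [hint, sgm, if_neg h1.ne']
    rw [div_le_iff₀ hη] at h5
    set X := r ^ (1 - s)
    set Y := ρ ^ (1 - s)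
    have hX : 0 < X := by positivity
    have e1 : X / ((d:ℝ) + 1) + (X - Y) / (s - 1) = (((d:ℝ) + s) / (d + 1)) * X / (s - 1) - Y / (s - 1) := by
      field_simp; ring
    have e2 : Y / (s - 1) ≤ η * ((((d:ℝ) + s) / (d + 1)) * X / (s - 1)) := by
      rw [mul_div_assoc', div_le_div_iff_of_pos_right hs1]
      have : 1 ≤ ((d:ℝ) + s) / (d + 1) := by rw [le_div_iff₀ (by positivity)]; linarith
      calc Y ≤ X * η := h5
        _ = η * (1 * X) := by ring
        _ ≤ _ := by gcongr
    rw [e1]; linarith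

lemma meas_ker (d : ℕ) (s r : ℝ) : Measurable (fun t => ENNReal.ofReal (_root_.ker d s r t)) := by
  apply Measurable.ennreal_ofReal
  unfold _root_.ker
  exact Measurable.ite measurableSet_Iic (by fun_prop) (by fun_prop)

lemma sgm_nonneg (d : ℕ) (s r : ℝ) (hs : 1 ≤ s) (hr : 0 < r) : 0 ≤ sgm d s r := by
  unfold sgm
  split_ifs
  · positivity
  · have : 0 ≤ s - 1 := by linarith
    positivity

lemma omegaB_pos (k : ℕ) : 0 < omegaB k :=
  ENNReal.toReal_pos (measure_ball_pos _ _ one_pos).ne' measure_ball_lt_top.ne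

lemma Cf_bound {d : ℕ} (hd : 2 ≤ d) (i0 : Fin d) (c κ : ℝ) (hc : 0 ≤ c) (hκ : 0 ≤ κ) :
    ENNReal.ofReal (c * omegaB (d - 1) - κ * (volume : Measure (Euc d)).toSphere.real univ) ≤
      ∫⁻ θ : sphere (0 : Euc d) 1, ENNReal.ofReal (c * θ.1 i0 - κ * ‖θ.1‖)
        ∂((volume : Measure (Euc d)).toSphere) := by
  rw [ENNReal.ofReal_sub _ (by positivity), tsub_le_iff_right, ENNReal.ofReal_mul hc,
    ← sphere_const hd i0, ENNReal.ofReal_mul hκ, ofReal_measureReal,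
    ← lintegral_const_mul _ (by fun_prop), ← lintegral_const, ← lintegral_add_right _ (by fun_prop)]
  refine lintegral_mono fun θ => ?_
  have h : ‖θ.1‖ = 1 := by simpa using θ.2
  simp only [h, mul_one]
  rw [← ENNReal.ofReal_mul hc]
  refine (ENNReal.ofReal_le_ofReal ?_).trans ENNReal.ofReal_add_le
  linarith

/-- Quantitative lower bound on the nonlocal energy of sets close (in a
unit cube `Q^ν` oriented along `ν`) to the half-space `H⁻_ν(0)`. -/
theorem stmt9 (d : ℕ) (hd : 2 ≤ d) (s : ℝ) (hs : 1 ≤ s) (ε : ℝ) (hε : 0 < ε) :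
    ∃ r₀ : ℝ, 0 < r₀ ∧ ∃ δ₀ : ℝ, 0 < δ₀ ∧
      ∀ ν : Euc d, ‖ν‖ = 1 →
      ∀ R : Euc d ≃ₗᵢ[ℝ] Euc d,
        R (EuclideanSpace.single (⟨d - 1, by omega⟩ : Fin d) 1) = ν →
      ∀ E : Set (Euc d), MeasurableSet E → volume E < ⊤ →
        volume ((E ∆ Hminus d ν) ∩ (R '' cube d 1 0)) ≤ ENNReal.ofReal δ₀ →
      ∀ r : ℝ, 0 < r → r < r₀ →
        ENNReal.ofReal (omegaB (d - 1) * (1 - ε) * sgm d s r) ≤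
          ∫⁻ x in (R '' cube d 1 0) ∩ E, ∫⁻ y in (R '' cube d 1 0) ∩ Eᶜ,
            ENNReal.ofReal (ker d s r (dist x y)) := by
  rcases le_or_gt 1 ε with hε1 | hε1
  · refine ⟨1, one_pos, 1, one_pos, ?_⟩
    intro ν _ R _ E _ _ _ r hr _
    rw [ENNReal.ofReal_of_nonpos]
    · exact zero_le
    · exact mul_nonpos_of_nonpos_of_nonneg
        (mul_nonpos_of_nonneg_of_nonpos (omegaB_pos _).le (by linarith)) (sgm_nonneg d s r hs hr)
  set i0 : Fin d := ⟨d - 1, by omega⟩ with hi0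
  set K := (volume : Measure (Euc d)).toSphere.real univ with hK
  have hK0 : 0 ≤ K := measureReal_nonneg
  set ω := omegaB (d - 1) with hω
  have hω0 : 0 < ω := omegaB_pos _
  have hd0 : (0:ℝ) < d := by exact_mod_cast (by omega : 0 < d)
  set T : ℝ := min (1/4) (ε / (6 * d)) with hT
  have hT0 : 0 < T := by positivity
  have hT1 : T ≤ 1/4 := min_le_left _ _
  have hT2 : T * (6 * d) ≤ ε := by
    have : T ≤ ε / (6 * d) := min_le_right _ _
    rwa [le_div_iff₀ (by positivity)] at this
  set δ : ℝ := ω * ε * T / (12 * (K + 1)) with hδ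
  have hδ0 : 0 < δ := by positivity
  set c : ℝ := (1 - 2 * T) ^ (d - 1) with hc
  have hc0 : 0 ≤ c := pow_nonneg (by linarith) _
  have hc1 : 1 - ε / 3 ≤ c := by
    have h := one_add_mul_le_pow (a := -(2 * T)) (by linarith) (d - 1)
    rw [← sub_eq_add_neg 1 (2 * T), ← hc] at h
    have h2 : ((d - 1 : ℕ) : ℝ) ≤ d := by exact_mod_cast Nat.sub_le _ _
    have h3 : ((d - 1 : ℕ) : ℝ) * (2 * T) ≤ d * (2 * T) := by gcongr
    linarith
  set κ : ℝ := 4 * δ / T with hκ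
  have hκ0 : 0 ≤ κ := by positivity
  have hκK : κ * K ≤ ω * ε / 3 := by
    have : κ = ω * ε / (3 * (K + 1)) := by
      rw [hκ, hδ]; field_simp; ring
    rw [this, div_mul_eq_mul_div, div_le_div_iff₀ (by positivity) (by norm_num)]
    have : 0 ≤ ω * ε := by positivity
    nlinarith
  obtain ⟨r₀, hr0, hr1, hr2, hr3⟩ := sgm_asymp d s (T / 2) hs (by positivity) (ε / 3) (by positivity)
  refine ⟨r₀, hr0, δ, hδ0, ?_⟩
  intro ν hν R hR E hE _ hvol r hr hrr
  rw [← hR] at hvol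
  have hQm : MeasurableSet (R '' cube d 1 0) :=
    R.toHomeomorph.measurableEmbedding.measurableSet_image.2 (meas_cube d)
  rw [energy_eq _ _ (hQm.inter hE.compl) _ (meas_ker d s r)]
  rw [← R.measurePreserving.lintegral_comp_emb R.toHomeomorph.measurableEmbedding]
  have hpol := polar_hom hd (fun u => ENNReal.ofReal (c * u i0 - κ * ‖u‖)) (by fun_prop)
    (by
      intro t ht x
      rw [← ENNReal.ofReal_mul ht.le]
      congr 1
      simp [norm_smul, abs_of_pos ht]
      ring)
    ((Iic (T / 2)).indicator (fun t => ENNReal.ofReal (_root_.ker d s r t)))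
    ((meas_ker d s r).indicator measurableSet_Iic)
  have hmono : ∫⁻ u : Euc d, (Iic (T / 2)).indicator (fun t => ENNReal.ofReal (_root_.ker d s r t)) ‖u‖ *
      ENNReal.ofReal (c * u i0 - κ * ‖u‖) ≤
      ∫⁻ u, ENNReal.ofReal (_root_.ker d s r ‖R u‖) *
        volume ((R '' cube d 1 0 ∩ E) ∩ (fun x => x + R u) ⁻¹' (R '' cube d 1 0 ∩ Eᶜ)) := by
    refine lintegral_mono fun u => ?_
    by_cases hu : ‖u‖ ≤ T / 2
    · simp only [indicator_of_mem (show ‖u‖ ∈ Iic (T / 2) from hu), R.norm_map]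
      gcongr
      exact A_bound i0 R E u T δ hT0 hT1 hδ0.le hu hvol
    · simp only [indicator_of_notMem (show ‖u‖ ∉ Iic (T / 2) from hu), zero_mul]
      exact zero_le
  refine le_trans ?_ hmono
  rw [hpol]
  have hCf := Cf_bound hd i0 c κ hc0 hκ0
  have hker := ker_int d s r (T / 2) hr (hrr.trans_le hr1)
  refine le_trans ?_ (mul_le_mul' hCf hker)
  have hσ := sgm_nonneg d s r hs hr
  have hA : ω * (1 - 2 * ε / 3) ≤ c * ω - κ * K := by nlinarith
  have hB := hr3 r hr hrr
  have hA0 : 0 ≤ ω * (1 - 2 * ε / 3) := mul_nonneg hω0.le (by linarith)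
  rw [← ENNReal.ofReal_mul (hA0.trans hA)]
  apply ENNReal.ofReal_le_ofReal
  refine le_trans ?_ (mul_le_mul hA hB (mul_nonneg (by linarith) hσ) (hA0.trans hA))
  have : 0 ≤ ω * sgm d s r * (2 * ε ^ 2 / 9) := by positivity
  nlinarith

end
end
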